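/- Let p ≥ 1, let λ = (λ₁,…,λ_p) be nonincreasing nonnegative weights with λ₁ > 0, and let x ∈ ℝ^p be a vector with exactly k nonzero entries (1 ≤ k ≤ p) whose nonzero entries have pairwise distinct absolute values. Fix δ > 0 and suppose δ < M_λ. Then liminf_{σ_z → 0⁺} δ(σ*(σ_z)² − σ_z²) > 0; in particular δ(σ*(σ_z)² − σ_z²)/σ_z² → ∞ as σ_z → 0⁺. -/

import Mathlib

open MeasureTheory ProbabilityTheory Filter

/-- Standard Gaussian measure `N(0, I_n)` on `ℝⁿ`. -/
noncomputable def stdGaussian (n : ℕ) : Measure (Fin n → ℝ) :=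
  Measure.pi fun _ => gaussianReal 0 1

/-- The nonincreasing rearrangement of the absolute values of the entries of `x`. -/
noncomputable def sortedAbs {n : ℕ} (x : Fin n → ℝ) : Fin n → ℝ :=
  fun i => |x ((Tuple.sort fun j => -|x j|) i)|

/-- The sorted-ℓ1 (SLOPE) norm `‖x‖_λ = ∑ λ_i |x|_(i)`. -/
noncomputable def slopeNorm {n : ℕ} (lam x : Fin n → ℝ) : ℝ :=
  ∑ i, lam i * sortedAbs x i

/-- The SLOPE proximal objective `½‖u − v‖₂² + γ‖v‖_λ`. -/
noncomputable def slopeObj {n : ℕ} (lam : Fin n → ℝ) (γ : ℝ) (u v : Fin n → ℝ) : ℝ :=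
  (1/2) * ∑ i, (u i - v i)^2 + γ * slopeNorm lam v

/-- `v` is a minimizer of the SLOPE proximal objective, i.e. `v = η(u; γ, λ)`
(the minimizer is unique since the objective is strictly convex). -/
def IsSlopeProx {n : ℕ} (lam : Fin n → ℝ) (γ : ℝ) (u v : Fin n → ℝ) : Prop :=
  ∀ w, slopeObj lam γ u v ≤ slopeObj lam γ u w

section SlopeNorm

variable {n : ℕ} {lam : Fin n → ℝ}

lemma sum_mul_comp_perm_le_of_antitone (hlam : Antitone lam) {f : Fin n → ℝ} (hf : Antitone f)
    (π : Equiv.Perm (Fin n)) : ∑ i, lam i * f (π i) ≤ ∑ i, lam i * f i :=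
  (hlam.monovary hf).sum_mul_comp_perm_le_sum_mul

lemma antitone_sortedAbs (x : Fin n → ℝ) : Antitone (sortedAbs x) := by
  intro i j hij
  have := Tuple.monotone_sort (fun j => -|x j|) hij
  simpa [sortedAbs] using this

lemma sum_mul_abs_perm_le_slopeNorm (hlam : Antitone lam) (x : Fin n → ℝ)
    (π : Equiv.Perm (Fin n)) : ∑ i, lam i * |x (π i)| ≤ slopeNorm lam x := by
  have := sum_mul_comp_perm_le_of_antitone hlam (antitone_sortedAbs x)
    (π.trans (Tuple.sort fun j => -|x j|).symm)
  simpa [sortedAbs, slopeNorm] using this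

lemma slopeNorm_eq_of_antitone (hlam : Antitone lam) (x : Fin n → ℝ) (π : Equiv.Perm (Fin n))
    (hπ : Antitone fun i => |x (π i)|) : slopeNorm lam x = ∑ i, lam i * |x (π i)| := by
  refine le_antisymm ?_ (sum_mul_abs_perm_le_slopeNorm hlam x π)
  have := sum_mul_comp_perm_le_of_antitone hlam hπ
    ((Tuple.sort fun j => -|x j|).trans π.symm)
  simpa [sortedAbs, slopeNorm] using this

lemma slopeNorm_const_mul (hlam : Antitone lam) {c : ℝ} (hc : 0 ≤ c) (x : Fin n → ℝ) :
    slopeNorm lam (fun i => c * x i) = c * slopeNorm lam x := by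
  rw [slopeNorm_eq_of_antitone hlam _ (Tuple.sort fun j => -|x j|), slopeNorm, Finset.mul_sum]
  · refine Finset.sum_congr rfl fun i _ => ?_
    rw [abs_mul, abs_of_nonneg hc, sortedAbs]
    ring
  · intro i j hij
    simp only [abs_mul]
    exact mul_le_mul_of_nonneg_left (antitone_sortedAbs x hij) (abs_nonneg c)

lemma slopeNorm_zero : slopeNorm lam (fun _ => 0) = 0 := by
  simp [slopeNorm, sortedAbs]

lemma slopeNorm_convex_comb_le (hlam : Antitone lam) (hnonneg : ∀ i, 0 ≤ lam i) {t : ℝ}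
    (ht0 : 0 ≤ t) (ht1 : t ≤ 1) (x y : Fin n → ℝ) :
    slopeNorm lam (fun i => x i + t * (y i - x i))
      ≤ (1 - t) * slopeNorm lam x + t * slopeNorm lam y := by
  set z : Fin n → ℝ := fun i => x i + t * (y i - x i) with hz
  set π := Tuple.sort fun j => -|z j|
  have h1 := sum_mul_abs_perm_le_slopeNorm hlam x π
  have h2 := sum_mul_abs_perm_le_slopeNorm hlam y π
  calc slopeNorm lam z = ∑ i, lam i * |z (π i)| := rfl
    _ ≤ ∑ i, ((1 - t) * (lam i * |x (π i)|) + t * (lam i * |y (π i)|)) := by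
        refine Finset.sum_le_sum fun i _ => ?_
        have hzi : z (π i) = (1 - t) * x (π i) + t * y (π i) := by simp only [hz]; ring
        have : |z (π i)| ≤ (1 - t) * |x (π i)| + t * |y (π i)| := by
          rw [hzi]
          refine (abs_add_le _ _).trans_eq ?_
          rw [abs_mul, abs_mul, abs_of_nonneg ht0, abs_of_nonneg (sub_nonneg.2 ht1)]
        have := mul_le_mul_of_nonneg_left this (hnonneg i)
        linarith
    _ = (1 - t) * ∑ i, lam i * |x (π i)| + t * ∑ i, lam i * |y (π i)| := by
        rw [Finset.sum_add_distrib, Finset.mul_sum, Finset.mul_sum]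
    _ ≤ _ := add_le_add (mul_le_mul_of_nonneg_left h1 (sub_nonneg.2 ht1))
        (mul_le_mul_of_nonneg_left h2 ht0)

lemma slopeNorm_nonneg (hnonneg : ∀ i, 0 ≤ lam i) (x : Fin n → ℝ) : 0 ≤ slopeNorm lam x :=
  Finset.sum_nonneg fun i _ => mul_nonneg (hnonneg i) (abs_nonneg _)

lemma mul_abs_le_slopeNorm (hlam : Antitone lam) (hnonneg : ∀ i, 0 ≤ lam i) (x : Fin n → ℝ)
    (i j : Fin n) : lam i * |x j| ≤ slopeNorm lam x := by
  refine le_trans ?_ (sum_mul_abs_perm_le_slopeNorm hlam x (Equiv.swap i j))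
  have := Finset.single_le_sum (f := fun l => lam l * |x (Equiv.swap i j l)|)
    (fun l _ => mul_nonneg (hnonneg l) (abs_nonneg _)) (Finset.mem_univ i)
  simpa using this

end SlopeNorm

section SplitNorm

variable {k q : ℕ} {lam : Fin (k + q) → ℝ}

/-- The permutation of `Fin (k + q)` that fixes the first block and acts by `ρ` on the second. -/
def lastBlockPerm (k : ℕ) {q : ℕ} (ρ : Equiv.Perm (Fin q)) : Equiv.Perm (Fin (k + q)) :=
  finSumFinEquiv.permCongr (Equiv.sumCongr (Equiv.refl (Fin k)) ρ)

@[simp]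
lemma lastBlockPerm_castAdd (ρ : Equiv.Perm (Fin q)) (i : Fin k) :
    lastBlockPerm k ρ (Fin.castAdd q i) = Fin.castAdd q i := by
  simp [lastBlockPerm, Equiv.permCongr_apply]

@[simp]
lemma lastBlockPerm_natAdd (ρ : Equiv.Perm (Fin q)) (j : Fin q) :
    lastBlockPerm k ρ (Fin.natAdd k j) = Fin.natAdd k (ρ j) := by
  simp [lastBlockPerm, Equiv.permCongr_apply]

lemma split_le_slopeNorm (hlam : Antitone lam) (τ : Equiv.Perm (Fin (k + q)))
    (w : Fin (k + q) → ℝ) :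
    ∑ i, lam (Fin.castAdd q i) * |w (τ (Fin.castAdd q i))|
      + slopeNorm (fun j => lam (Fin.natAdd k j)) (fun j => w (τ (Fin.natAdd k j)))
      ≤ slopeNorm lam w := by
  have := sum_mul_abs_perm_le_slopeNorm hlam w
    ((lastBlockPerm k (Tuple.sort fun j => -|w (τ (Fin.natAdd k j))|)).trans τ)
  rw [Fin.sum_univ_add] at this
  simpa [slopeNorm, sortedAbs] using this

lemma slopeNorm_eq_split (hlam : Antitone lam) (τ : Equiv.Perm (Fin (k + q)))
    (w : Fin (k + q) → ℝ)
    (hord : ∀ (i : Fin k) (j : Fin (k + q)), Fin.castAdd q i < j →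
      |w (τ j)| ≤ |w (τ (Fin.castAdd q i))|) :
    slopeNorm lam w = ∑ i, lam (Fin.castAdd q i) * |w (τ (Fin.castAdd q i))|
      + slopeNorm (fun j => lam (Fin.natAdd k j)) (fun j => w (τ (Fin.natAdd k j))) := by
  rw [slopeNorm_eq_of_antitone hlam w
    ((lastBlockPerm k (Tuple.sort fun j => -|w (τ (Fin.natAdd k j))|)).trans τ),
    Fin.sum_univ_add]
  · simp [slopeNorm, sortedAbs]
  · intro a b hab
    induction a using Fin.addCases with
    | left i =>
      induction b using Fin.addCases with
      | left j =>
        rcases hab.eq_or_lt with h | h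
        · rw [h]
        · simpa using hord i _ h
      | right j => simpa using hord i _ (by simp [Fin.lt_def]; omega)
    | right i =>
      induction b using Fin.addCases with
      | left j => simp [Fin.le_def] at hab; omega
      | right j =>
        have hij : i ≤ j := by simpa using hab
        have := antitone_sortedAbs (fun j => w (τ (Fin.natAdd k j))) hij
        simpa [sortedAbs] using this

end SplitNorm

section Prox

variable {n : ℕ} {lam : Fin n → ℝ} {γ : ℝ} {u v u' v' : Fin n → ℝ}

lemma slopeObj_add (w : Fin n → ℝ) :
    slopeObj lam γ u w = slopeObj lam γ u v + 1 / 2 * ∑ i, (w i - v i) ^ 2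
      - ∑ i, (u i - v i) * (w i - v i) + γ * (slopeNorm lam w - slopeNorm lam v) := by
  have : ∑ i, (u i - w i) ^ 2 = ∑ i, (u i - v i) ^ 2 + ∑ i, (w i - v i) ^ 2
      - 2 * ∑ i, (u i - v i) * (w i - v i) := by
    rw [Finset.mul_sum, ← Finset.sum_add_distrib, ← Finset.sum_sub_distrib]
    exact Finset.sum_congr rfl fun i _ => by ring
  simp only [slopeObj, this]
  ring

/-- The variational inequality characterizing the proximal point. -/
lemma isSlopeProx_iff (hlam : Antitone lam) (hnonneg : ∀ i, 0 ≤ lam i) (hγ : 0 ≤ γ) :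
    IsSlopeProx lam γ u v ↔ ∀ w : Fin n → ℝ,
      ∑ i, (u i - v i) * (w i - v i) ≤ γ * (slopeNorm lam w - slopeNorm lam v) := by
  refine ⟨fun hv w => ?_, fun hv w => ?_⟩
  · set A := ∑ i, (u i - v i) * (w i - v i)
    set B := ∑ i, (w i - v i) ^ 2
    have key : ∀ t : ℝ, 0 < t → t ≤ 1 →
        A ≤ γ * (slopeNorm lam w - slopeNorm lam v) + t * (B / 2) := by
      intro t ht0 ht1
      have h1 := hv fun i => v i + t * (w i - v i)
      rw [slopeObj_add (v := v) fun i => v i + t * (w i - v i)] at h1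
      have h2 := mul_le_mul_of_nonneg_left
        (slopeNorm_convex_comb_le hlam hnonneg ht0.le ht1 v w) hγ
      have h3 : ∑ i, (v i + t * (w i - v i) - v i) ^ 2 = t ^ 2 * B := by
        rw [Finset.mul_sum]; exact Finset.sum_congr rfl fun i _ => by ring
      have h4 : ∑ i, (u i - v i) * (v i + t * (w i - v i) - v i) = t * A := by
        rw [Finset.mul_sum]; exact Finset.sum_congr rfl fun i _ => by ring
      rw [h3, h4] at h1
      refine le_of_mul_le_mul_left ?_ ht0
      nlinarith
    have hlim : Tendsto (fun t : ℝ => γ * (slopeNorm lam w - slopeNorm lam v) + t * (B / 2))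
        (nhdsWithin 0 (Set.Ioi 0)) (nhds (γ * (slopeNorm lam w - slopeNorm lam v))) := by
      have : Continuous fun t : ℝ =>
          γ * (slopeNorm lam w - slopeNorm lam v) + t * (B / 2) := by fun_prop
      simpa using (this.tendsto 0).mono_left nhdsWithin_le_nhds
    refine ge_of_tendsto hlim ?_
    filter_upwards [Ioc_mem_nhdsGT (zero_lt_one' ℝ)] with t ht using key t ht.1 ht.2
  · rw [slopeObj_add (v := v) w]
    have : 0 ≤ ∑ i, (w i - v i) ^ 2 := Finset.sum_nonneg fun i _ => sq_nonneg _
    linarith [hv w]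

lemma IsSlopeProx.sum_sq_sub_le (hlam : Antitone lam) (hnonneg : ∀ i, 0 ≤ lam i) (hγ : 0 ≤ γ)
    (hv : IsSlopeProx lam γ u v) (hv' : IsSlopeProx lam γ u' v') :
    ∑ i, (v i - v' i) ^ 2 ≤ ∑ i, (u i - u' i) ^ 2 := by
  have h1 := (isSlopeProx_iff hlam hnonneg hγ).1 hv v'
  have h2 := (isSlopeProx_iff hlam hnonneg hγ).1 hv' v
  have h3 : ∑ i, (v i - v' i) ^ 2 + ∑ i, (u i - u' i - (v i - v' i)) ^ 2
      - ∑ i, (u i - u' i) ^ 2 = 2 * (∑ i, (u i - v i) * (v' i - v i)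
        + ∑ i, (u' i - v' i) * (v i - v' i)) := by
    rw [← Finset.sum_add_distrib, ← Finset.sum_add_distrib, ← Finset.sum_sub_distrib,
      Finset.mul_sum]
    exact Finset.sum_congr rfl fun i _ => by ring
  have h4 : 0 ≤ ∑ i, (u i - u' i - (v i - v' i)) ^ 2 := Finset.sum_nonneg fun i _ => sq_nonneg _
  linarith

lemma IsSlopeProx.unique (hlam : Antitone lam) (hnonneg : ∀ i, 0 ≤ lam i) (hγ : 0 ≤ γ)
    (hv : IsSlopeProx lam γ u v) (hv' : IsSlopeProx lam γ u v') : v = v' := by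
  have h := hv.sum_sq_sub_le hlam hnonneg hγ hv'
  simp only [sub_self, ne_eq, OfNat.ofNat_ne_zero, not_false_eq_true, zero_pow,
    Finset.sum_const_zero] at h
  ext i
  have := (Finset.sum_eq_zero_iff_of_nonneg fun i _ => sq_nonneg (v i - v' i)).1
    (le_antisymm h (Finset.sum_nonneg fun i _ => sq_nonneg _)) i (Finset.mem_univ i)
  exact sub_eq_zero.1 (pow_eq_zero_iff two_ne_zero |>.1 this)

lemma IsSlopeProx.mul_slopeNorm_le (hlam : Antitone lam) (hnonneg : ∀ i, 0 ≤ lam i)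
    (hγ : 0 ≤ γ) (hv : IsSlopeProx lam γ u v) :
    γ * slopeNorm lam v ≤ ∑ i, (u i - v i) * v i := by
  have := (isSlopeProx_iff hlam hnonneg hγ).1 hv fun _ => 0
  simp only [slopeNorm_zero, zero_sub, mul_neg, Finset.sum_neg_distrib] at this
  linarith

lemma IsSlopeProx.sum_sq_le (hlam : Antitone lam) (hnonneg : ∀ i, 0 ≤ lam i) (hγ : 0 ≤ γ)
    (hv : IsSlopeProx lam γ u v) : ∑ i, v i ^ 2 ≤ ∑ i, u i ^ 2 := by
  have h1 := hv.mul_slopeNorm_le hlam hnonneg hγ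
  have h2 : 0 ≤ γ * slopeNorm lam v := mul_nonneg hγ (slopeNorm_nonneg hnonneg v)
  have h3 : ∑ i, u i ^ 2 - ∑ i, v i ^ 2
      = 2 * ∑ i, (u i - v i) * v i + ∑ i, (u i - v i) ^ 2 := by
    rw [Finset.mul_sum, ← Finset.sum_add_distrib, ← Finset.sum_sub_distrib]
    exact Finset.sum_congr rfl fun i _ => by ring
  have h4 : 0 ≤ ∑ i, (u i - v i) ^ 2 := Finset.sum_nonneg fun i _ => sq_nonneg _
  linarith

lemma IsSlopeProx.mul_abs_le (hlam : Antitone lam) (hnonneg : ∀ i, 0 ≤ lam i) (hγ : 0 ≤ γ)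
    (hv : IsSlopeProx lam γ u v) (i j : Fin n) : γ * lam i * |v j| ≤ ∑ i, u i ^ 2 := by
  have h1 := hv.mul_slopeNorm_le hlam hnonneg hγ
  have h2 := mul_le_mul_of_nonneg_left (mul_abs_le_slopeNorm hlam hnonneg v i j) hγ
  have h3 : ∑ i, (u i - v i) * v i ≤ ∑ i, u i ^ 2 :=
    Finset.sum_le_sum fun i _ => by nlinarith [sq_nonneg (u i - 2 * v i), sq_nonneg (u i)]
  linarith

lemma IsSlopeProx.eq_zero_or_le_sum_sq_sub (hlam : Antitone lam) (hnonneg : ∀ i, 0 ≤ lam i)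
    (hγ : 0 ≤ γ) (hv : IsSlopeProx lam γ u v) (i : Fin n) :
    v = 0 ∨ (γ * lam i) ^ 2 ≤ n * ∑ j, (u j - v j) ^ 2 := by
  rw [or_iff_not_imp_left]
  intro hv0
  set S := slopeNorm lam v
  have hVpos : 0 < ∑ j, v j ^ 2 := by
    obtain ⟨j, hj⟩ := Function.ne_iff.1 hv0
    exact Finset.sum_pos' (fun j _ => sq_nonneg _) ⟨j, Finset.mem_univ j, sq_pos_of_ne_zero hj⟩
  have h1 := hv.mul_slopeNorm_le hlam hnonneg hγ
  have h2 : lam i ^ 2 * ∑ j, v j ^ 2 ≤ n * S ^ 2 := by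
    calc lam i ^ 2 * ∑ j, v j ^ 2 = ∑ j, (lam i * |v j|) ^ 2 := by
          rw [Finset.mul_sum]; exact Finset.sum_congr rfl fun j _ => by rw [mul_pow, sq_abs]
      _ ≤ ∑ _j : Fin n, S ^ 2 := Finset.sum_le_sum fun j _ =>
          pow_le_pow_left₀ (mul_nonneg (hnonneg i) (abs_nonneg _))
            (mul_abs_le_slopeNorm hlam hnonneg v i j) 2
      _ = n * S ^ 2 := by simp
  have h3 : (γ * S) ^ 2 ≤ (∑ j, (u j - v j) ^ 2) * ∑ j, v j ^ 2 :=
    (pow_le_pow_left₀ (mul_nonneg hγ (slopeNorm_nonneg hnonneg v)) h1 2).trans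
      (Finset.sum_mul_sq_le_sq_mul_sq _ _ _)
  refine le_of_mul_le_mul_right ?_ hVpos
  have h4 := mul_le_mul_of_nonneg_left h2 (sq_nonneg γ)
  have h5 := mul_le_mul_of_nonneg_left h3 (Nat.cast_nonneg (α := ℝ) n)
  nlinarith

lemma continuous_slopeProx (hlam : Antitone lam) (hnonneg : ∀ i, 0 ≤ lam i) (hγ : 0 ≤ γ)
    {η : (Fin n → ℝ) → Fin n → ℝ} (hη : ∀ u, IsSlopeProx lam γ u (η u)) : Continuous η := by
  refine continuous_iff_continuousAt.2 fun u₀ => tendsto_pi_nhds.2 fun i => ?_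
  rw [tendsto_iff_dist_tendsto_zero]
  have hc : Continuous fun u : Fin n → ℝ => √(∑ j, (u j - u₀ j) ^ 2) := by fun_prop
  have h0 := hc.tendsto u₀
  simp only [sub_self, ne_eq, OfNat.ofNat_ne_zero, not_false_eq_true, zero_pow,
    Finset.sum_const_zero, Real.sqrt_zero] at h0
  refine squeeze_zero (fun _ => dist_nonneg) (fun u => ?_) h0
  rw [Real.dist_eq]
  refine Real.le_sqrt_of_sq_le ?_
  rw [sq_abs]
  exact (Finset.single_le_sum (f := fun j => (η u j - η u₀ j) ^ 2) (fun j _ => sq_nonneg _)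
    (Finset.mem_univ i)).trans ((hη u).sum_sq_sub_le hlam hnonneg hγ (hη u₀))

end Prox

section SplitProx

variable {k q : ℕ} {lam : Fin (k + q) → ℝ}

/-- Block description of the proximal point when the first `k` sorted entries dominate. -/
lemma isSlopeProx_of_split (hlam : Antitone lam) (hnonneg : ∀ i, 0 ≤ lam i)
    (τ : Equiv.Perm (Fin (k + q))) {x h v : Fin (k + q) → ℝ} {z : Fin q → ℝ} {s : Fin k → ℝ}
    {σ χ : ℝ} (hσ : 0 ≤ σ) (hχ : 0 ≤ χ)
    (hz : IsSlopeProx (fun j => lam (Fin.natAdd k j)) χ (fun j => h (τ (Fin.natAdd k j))) z)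
    (hx : ∀ j : Fin q, x (τ (Fin.natAdd k j)) = 0)
    (hv₁ : ∀ i : Fin k, v (τ (Fin.castAdd q i)) = x (τ (Fin.castAdd q i))
      + σ * (h (τ (Fin.castAdd q i)) - χ * lam (Fin.castAdd q i) * s i))
    (hv₂ : ∀ j : Fin q, v (τ (Fin.natAdd k j)) = σ * z j)
    (hs : ∀ i, |s i| ≤ 1) (hsv : ∀ i, s i * v (τ (Fin.castAdd q i)) = |v (τ (Fin.castAdd q i))|)
    (hord : ∀ (i : Fin k) (j : Fin (k + q)), Fin.castAdd q i < j →
      |v (τ j)| ≤ |v (τ (Fin.castAdd q i))|) :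
    IsSlopeProx lam (σ * χ) (fun i => x i + σ * h i) v := by
  have hanti : Antitone fun j => lam (Fin.natAdd k j) := fun i j hij =>
    hlam ((Fin.natAdd_le_natAdd_iff k).2 hij)
  refine (isSlopeProx_iff hlam hnonneg (mul_nonneg hσ hχ)).2 fun w => ?_
  rw [← Equiv.sum_comp τ, Fin.sum_univ_add, slopeNorm_eq_split hlam τ v hord]
  have hw := mul_le_mul_of_nonneg_left (split_le_slopeNorm hlam τ w) (mul_nonneg hσ hχ)
  have e1 : ∑ i : Fin k, (x (τ (Fin.castAdd q i)) + σ * h (τ (Fin.castAdd q i))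
      - v (τ (Fin.castAdd q i))) * (w (τ (Fin.castAdd q i)) - v (τ (Fin.castAdd q i)))
      ≤ σ * χ * (∑ i, lam (Fin.castAdd q i) * |w (τ (Fin.castAdd q i))|
        - ∑ i, lam (Fin.castAdd q i) * |v (τ (Fin.castAdd q i))|) := by
    rw [← Finset.sum_sub_distrib, Finset.mul_sum]
    refine Finset.sum_le_sum fun i _ => ?_
    have h1 : s i * w (τ (Fin.castAdd q i)) ≤ |w (τ (Fin.castAdd q i))| := by
      refine (le_abs_self _).trans ?_
      rw [abs_mul]
      exact mul_le_of_le_one_left (abs_nonneg _) (hs i)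
    have h2 := mul_le_mul_of_nonneg_left h1
      (mul_nonneg (mul_nonneg hσ hχ) (hnonneg (Fin.castAdd q i)))
    have h3 : x (τ (Fin.castAdd q i)) + σ * h (τ (Fin.castAdd q i)) - v (τ (Fin.castAdd q i))
        = σ * χ * lam (Fin.castAdd q i) * s i := by rw [hv₁]; ring
    rw [h3, ← hsv i]
    linarith
  have e2 : ∑ j : Fin q, (x (τ (Fin.natAdd k j)) + σ * h (τ (Fin.natAdd k j))
      - v (τ (Fin.natAdd k j))) * (w (τ (Fin.natAdd k j)) - v (τ (Fin.natAdd k j)))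
      ≤ σ * χ * (slopeNorm (fun j => lam (Fin.natAdd k j)) (fun j => w (τ (Fin.natAdd k j)))
        - slopeNorm (fun j => lam (Fin.natAdd k j)) (fun j => v (τ (Fin.natAdd k j)))) := by
    simp only [hv₂, hx, zero_add]
    rw [slopeNorm_const_mul hanti hσ]
    rcases hσ.eq_or_lt with rfl | hσ'
    · simp
    have := (isSlopeProx_iff hanti (fun j => hnonneg _) hχ).1 hz
      fun j => σ⁻¹ * w (τ (Fin.natAdd k j))
    rw [slopeNorm_const_mul hanti (inv_nonneg.2 hσ)] at this
    have := mul_le_mul_of_nonneg_left this (sq_nonneg σ)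
    rw [Finset.mul_sum] at this
    refine (Finset.sum_congr rfl fun j _ => ?_).trans_le (this.trans_eq ?_) <;> field_simp
  linarith

end SplitProx

section Gaussian

variable {n : ℕ}

instance : IsProbabilityMeasure (stdGaussian n) := by
  unfold _root_.stdGaussian; infer_instance

lemma measurePreserving_eval_stdGaussian (i : Fin n) :
    MeasurePreserving (fun h : Fin n → ℝ => h i) (stdGaussian n) (gaussianReal 0 1) :=
  measurePreserving_eval (fun _ : Fin n => gaussianReal 0 1) i

lemma measurePreserving_comp_stdGaussian {m : ℕ} {f : Fin m → Fin n}
    (hf : Function.Injective f) :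
    MeasurePreserving (fun (h : Fin n → ℝ) j => h (f j)) (stdGaussian n) (stdGaussian m) := by
  refine ⟨by fun_prop, ?_⟩
  have h1 : iIndepFun (fun (i : Fin n) (ω : Fin n → ℝ) => ω i) (stdGaussian n) :=
    iIndepFun_pi (X := fun _ => id) fun _ => aemeasurable_id
  rw [(iIndepFun_iff_map_fun_eq_pi_map fun j => (measurable_pi_apply _).aemeasurable).1 (h1.precomp hf)]
  exact congrArg Measure.pi (funext fun j => (measurePreserving_eval_stdGaussian (f j)).map_eq)

lemma integrable_eval_stdGaussian (i : Fin n) :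
    Integrable (fun h : Fin n → ℝ => h i) (stdGaussian n) :=
  (measurePreserving_eval_stdGaussian i).integrable_comp_of_integrable
    ((memLp_id_gaussianReal 1).integrable (by simp))

lemma integrable_eval_sq_stdGaussian (i : Fin n) :
    Integrable (fun h : Fin n → ℝ => h i ^ 2) (stdGaussian n) :=
  (measurePreserving_eval_stdGaussian i).integrable_comp_of_integrable
    (g := fun t => t ^ 2) (memLp_id_gaussianReal 2).integrable_sq

lemma integral_eval_stdGaussian (i : Fin n) : ∫ h, h i ∂stdGaussian n = 0 := by
  have := integral_map (μ := stdGaussian n) (φ := fun h => h i) (f := fun t : ℝ => t)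
    (measurable_pi_apply i).aemeasurable (by fun_prop)
  rw [(measurePreserving_eval_stdGaussian i).map_eq, integral_id_gaussianReal] at this
  exact this.symm

lemma integral_eval_sq_stdGaussian (i : Fin n) : ∫ h, h i ^ 2 ∂stdGaussian n = 1 := by
  have := integral_map (μ := stdGaussian n) (φ := fun h => h i) (f := fun t : ℝ => t ^ 2)
    (measurable_pi_apply i).aemeasurable (by fun_prop)
  rw [(measurePreserving_eval_stdGaussian i).map_eq] at this
  rw [← this, ← variance_of_integral_eq_zero (by fun_prop) integral_id_gaussianReal,
    variance_fun_id_gaussianReal]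
  simp

lemma integrable_sum_sq_stdGaussian :
    Integrable (fun h : Fin n → ℝ => ∑ i, h i ^ 2) (stdGaussian n) :=
  integrable_finsetSum _ fun i _ => integrable_eval_sq_stdGaussian i

lemma integral_sum_sq_stdGaussian : ∫ h, ∑ i, h i ^ 2 ∂stdGaussian n = n := by
  rw [integral_finsetSum _ fun i _ => integrable_eval_sq_stdGaussian i]
  simp [integral_eval_sq_stdGaussian]

lemma integrable_sub_sq_stdGaussian (i : Fin n) (c : ℝ) :
    Integrable (fun h : Fin n → ℝ => (h i - c) ^ 2) (stdGaussian n) := by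
  have := ((integrable_eval_sq_stdGaussian i).sub
    ((integrable_eval_stdGaussian i).const_mul (2 * c))).add (integrable_const (c ^ 2))
  refine this.congr (ae_of_all _ fun h => ?_)
  simp only [Pi.add_apply, Pi.sub_apply]
  ring

lemma integral_sub_sq_stdGaussian (i : Fin n) (c : ℝ) :
    ∫ h, (h i - c) ^ 2 ∂stdGaussian n = 1 + c ^ 2 := by
  have h1 : ∀ h : Fin n → ℝ, (h i - c) ^ 2 = h i ^ 2 - 2 * c * h i + c ^ 2 := fun h => by ring
  simp only [h1]
  have h2 := integrable_eval_sq_stdGaussian i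
  have h3 := (integrable_eval_stdGaussian i).const_mul (2 * c)
  rw [integral_add (f := fun h : Fin n → ℝ => h i ^ 2 - 2 * c * h i) (h2.sub h3) (integrable_const _),
    integral_sub h2 h3, integral_const_mul,
    integral_eval_sq_stdGaussian, integral_eval_stdGaussian]
  simp

/-- Tail integrals of an integrable function over large balls become small. -/
lemma exists_setIntegral_compl_sum_sq_le {B : (Fin n → ℝ) → ℝ}
    (hB : Integrable B (stdGaussian n)) {ε : ℝ} (hε : 0 < ε) :
    ∃ R : ℝ, 0 < R ∧
      ∫ h in {h : Fin n → ℝ | R ^ 2 < ∑ i, h i ^ 2}, B h ∂stdGaussian n ≤ ε := by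
  have hmeas : ∀ m : ℕ, MeasurableSet {h : Fin n → ℝ | ((m : ℝ) + 1) ^ 2 < ∑ i, h i ^ 2} :=
    fun m => measurableSet_lt measurable_const (by fun_prop)
  have hanti : Antitone fun m : ℕ => {h : Fin n → ℝ | ((m : ℝ) + 1) ^ 2 < ∑ i, h i ^ 2} := by
    intro a b hab h hh
    have hab' : (a : ℝ) ≤ b := Nat.cast_le.2 hab
    have h1 : ((a : ℝ) + 1) ^ 2 ≤ ((b : ℝ) + 1) ^ 2 := by gcongr
    exact h1.trans_lt hh
  have hlim := tendsto_setIntegral_of_antitone (μ := stdGaussian n) (f := B) hmeas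
    hanti ⟨0, hB.integrableOn⟩
  have hempty : ⋂ m : ℕ, {h : Fin n → ℝ | ((m : ℝ) + 1) ^ 2 < ∑ i, h i ^ 2} = ∅ := by
    refine Set.eq_empty_of_forall_notMem fun h hh => ?_
    obtain ⟨m, hm⟩ := exists_nat_ge (∑ i, h i ^ 2)
    have h1 : ((m : ℝ) + 1) ^ 2 < ∑ i, h i ^ 2 := Set.mem_iInter.1 hh m
    nlinarith [Nat.cast_nonneg (α := ℝ) m]
  rw [hempty, setIntegral_empty] at hlim
  obtain ⟨m, hm⟩ := (hlim.eventually (gt_mem_nhds hε)).exists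
  exact ⟨m + 1, by positivity, hm.le⟩

end Gaussian

section Risk

variable {n : ℕ} {lam : Fin n → ℝ} {η : (Fin n → ℝ) → Fin n → ℝ} {γ σ : ℝ} {x : Fin n → ℝ}

lemma IsSlopeProx.sum_sq_error_le {v h : Fin n → ℝ} (hlam : Antitone lam)
    (hnonneg : ∀ i, 0 ≤ lam i) (hγ : 0 ≤ γ)
    (hv : IsSlopeProx lam γ (fun i => x i + σ * h i) v) :
    ∑ i, (v i - x i) ^ 2 ≤ 6 * ∑ i, x i ^ 2 + 4 * σ ^ 2 * ∑ i, h i ^ 2 := by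
  have h1 := hv.sum_sq_le hlam hnonneg hγ
  have h2 : ∑ i, (v i - x i) ^ 2 ≤ 2 * ∑ i, v i ^ 2 + 2 * ∑ i, x i ^ 2 := by
    rw [Finset.mul_sum, Finset.mul_sum, ← Finset.sum_add_distrib]
    exact Finset.sum_le_sum fun i _ => by nlinarith [sq_nonneg (v i + x i)]
  have h3 : ∑ i, (x i + σ * h i) ^ 2 ≤ 2 * ∑ i, x i ^ 2 + 2 * σ ^ 2 * ∑ i, h i ^ 2 := by
    rw [Finset.mul_sum, Finset.mul_sum, ← Finset.sum_add_distrib]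
    exact Finset.sum_le_sum fun i _ => by nlinarith [sq_nonneg (x i - σ * h i)]
  linarith

lemma continuous_sum_sq_error (hlam : Antitone lam) (hnonneg : ∀ i, 0 ≤ lam i) (hγ : 0 ≤ γ)
    (hη : ∀ u, IsSlopeProx lam γ u (η u)) :
    Continuous fun h : Fin n → ℝ => ∑ i, (η (fun j => x j + σ * h j) i - x i) ^ 2 := by
  have := continuous_slopeProx hlam hnonneg hγ hη
  fun_prop

lemma integrable_sum_sq_error (hlam : Antitone lam) (hnonneg : ∀ i, 0 ≤ lam i) (hγ : 0 ≤ γ)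
    (hη : ∀ u, IsSlopeProx lam γ u (η u)) :
    Integrable (fun h : Fin n → ℝ => ∑ i, (η (fun j => x j + σ * h j) i - x i) ^ 2)
      (stdGaussian n) := by
  refine Integrable.mono' ((integrable_const (6 * ∑ i, x i ^ 2)).add
    (integrable_sum_sq_stdGaussian.const_mul (4 * σ ^ 2)))
    (continuous_sum_sq_error hlam hnonneg hγ hη).aestronglyMeasurable (ae_of_all _ fun h => ?_)
  rw [Real.norm_of_nonneg (Finset.sum_nonneg fun i _ => sq_nonneg _)]
  exact (hη _).sum_sq_error_le hlam hnonneg hγ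

lemma integrable_sum_sq_prox (hlam : Antitone lam) (hnonneg : ∀ i, 0 ≤ lam i) (hγ : 0 ≤ γ)
    (hη : ∀ u, IsSlopeProx lam γ u (η u)) :
    Integrable (fun h : Fin n → ℝ => ∑ i, η h i ^ 2) (stdGaussian n) := by
  simpa using integrable_sum_sq_error (x := 0) (σ := 1) hlam hnonneg hγ hη

/-- With enough regularization the risk is at least a prescribed multiple of the noise level. -/
lemma mul_le_integral_sum_sq_error_of_large (hlam : Antitone lam) (hnonneg : ∀ i, 0 ≤ lam i)
    (hn : 0 < n) {χ T : ℝ} (hσ : 0 < σ) (hχ : 0 < χ)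
    (hη : ∀ u, IsSlopeProx lam (σ * χ) u (η u)) (i : Fin n)
    (hx : σ ^ 2 * T ≤ ∑ j, x j ^ 2) (hT : 2 * n * T ≤ (χ * lam i) ^ 2) :
    σ ^ 2 * (T - n) ≤
      ∫ h, ∑ j, (η (fun l => x l + σ * h l) j - x j) ^ 2 ∂stdGaussian n := by
  have hγ : 0 ≤ σ * χ := by positivity
  have e : ∫ h, σ ^ 2 * (T - ∑ j, h j ^ 2) ∂stdGaussian n = σ ^ 2 * (T - n) := by
    rw [integral_const_mul, integral_sub (integrable_const _) integrable_sum_sq_stdGaussian,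
      integral_sum_sq_stdGaussian]
    simp
  rw [← e]
  refine integral_mono (((integrable_const T).sub integrable_sum_sq_stdGaussian).const_mul _)
    (integrable_sum_sq_error hlam hnonneg hγ hη) fun h => ?_
  set v := η fun l => x l + σ * h l with hv
  have hN : 0 ≤ ∑ j, h j ^ 2 := Finset.sum_nonneg fun _ _ => sq_nonneg _
  change σ ^ 2 * (T - ∑ j, h j ^ 2) ≤ ∑ j, (v j - x j) ^ 2
  rcases (hη fun l => x l + σ * h l).eq_zero_or_le_sum_sq_sub hlam hnonneg hγ i with h0 | h1
  · rw [← hv] at h0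
    simp only [h0, Pi.zero_apply, zero_sub, neg_sq]
    nlinarith [sq_nonneg σ, mul_nonneg (sq_nonneg σ) hN]
  · rw [← hv] at h1
    have h2 : ∑ j, (x j + σ * h j - v j) ^ 2
        ≤ 2 * ∑ j, (v j - x j) ^ 2 + 2 * σ ^ 2 * ∑ j, h j ^ 2 := by
      rw [Finset.mul_sum, Finset.mul_sum, ← Finset.sum_add_distrib]
      exact Finset.sum_le_sum fun j _ => by nlinarith [sq_nonneg (x j - v j - σ * h j)]
    have hn' : (0 : ℝ) < 2 * n := by positivity
    refine le_of_mul_le_mul_left ?_ hn'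
    have h3 := mul_le_mul_of_nonneg_left hT (sq_nonneg σ)
    have h4 := mul_le_mul_of_nonneg_left h2 (Nat.cast_nonneg (α := ℝ) n)
    nlinarith

/-- As the regularization grows the risk drops below any level above `∑ xᵢ²`. -/
lemma exists_integral_sum_sq_error_lt (hlam : Antitone lam) (hnonneg : ∀ i, 0 ≤ lam i)
    (hσ : 0 < σ) {η : ℝ → (Fin n → ℝ) → Fin n → ℝ}
    (hη : ∀ γ u, 0 ≤ γ → IsSlopeProx lam γ u (η γ u)) (i : Fin n) (hi : 0 < lam i)
    {K : ℝ} (hK : ∑ j, x j ^ 2 < K) :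
    ∃ χ : ℝ, 0 < χ ∧
      ∫ h, ∑ j, (η (σ * χ) (fun l => x l + σ * h l) j - x j) ^ 2 ∂stdGaussian n < K := by
  have hγ : ∀ m : ℕ, 0 < σ * ((m : ℝ) + 1) := fun m => by positivity
  have hlim : Tendsto (fun m : ℕ => ∫ h, ∑ j,
      (η (σ * ((m : ℝ) + 1)) (fun l => x l + σ * h l) j - x j) ^ 2 ∂stdGaussian n) atTop
      (nhds (∫ _h, ∑ j, x j ^ 2 ∂stdGaussian n)) := by
    refine tendsto_integral_of_dominated_convergence
      (fun h => 6 * ∑ i, x i ^ 2 + 4 * σ ^ 2 * ∑ i, h i ^ 2)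
      (fun m => (continuous_sum_sq_error hlam hnonneg (hγ m).le
        fun u => hη _ u (hγ m).le).aestronglyMeasurable)
      ((integrable_const _).add (integrable_sum_sq_stdGaussian.const_mul _))
      (fun m => ae_of_all _ fun h => ?_) (ae_of_all _ fun h => ?_)
    · rw [Real.norm_of_nonneg (Finset.sum_nonneg fun i _ => sq_nonneg _)]
      exact (hη _ _ (hγ m).le).sum_sq_error_le hlam hnonneg (hγ m).le
    · refine tendsto_finsetSum _ fun j _ => ?_
      have h0 : Tendsto (fun m : ℕ => η (σ * ((m : ℝ) + 1)) (fun l => x l + σ * h l) j) atTop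
          (nhds 0) := by
        refine squeeze_zero_norm (a := fun m : ℕ =>
          (∑ l, (x l + σ * h l) ^ 2) / (σ * lam i) * (1 / ((m : ℝ) + 1))) (fun m => ?_) ?_
        · have := (hη _ (fun l => x l + σ * h l) (hγ m).le).mul_abs_le hlam hnonneg (hγ m).le i j
          rw [Real.norm_eq_abs, div_mul_div_comm, mul_one, le_div_iff₀ (by positivity)]
          linarith
        · simpa using tendsto_one_div_add_atTop_nhds_zero_nat.const_mul
            ((∑ l, (x l + σ * h l) ^ 2) / (σ * lam i))
      simpa using (h0.sub_const (x j)).pow 2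
  rw [integral_const, probReal_univ, one_smul] at hlim
  obtain ⟨m, hm⟩ := (hlim.eventually (gt_mem_nhds hK)).exists
  exact ⟨m + 1, by positivity, hm⟩

end Risk

section SmallNoise

/-- `Real.sign a` times a small perturbation of `a` is the absolute value of that perturbation. -/
lemma sign_mul_eq_abs_of_abs_sub_le {a b ρ : ℝ} (hρ : 0 < ρ) (ha : 2 * ρ ≤ |a|)
    (hab : |b - a| ≤ ρ) : Real.sign a * b = |b| := by
  obtain ⟨h1, h2⟩ := abs_le.1 hab
  rcases lt_trichotomy a 0 with h | h | h
  · rw [abs_of_neg h] at ha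
    rw [Real.sign_of_neg h, abs_of_neg (by linarith)]
    ring
  · rw [h, abs_zero] at ha
    linarith
  · rw [abs_of_pos h] at ha
    rw [Real.sign_of_pos h, abs_of_pos (by linarith)]
    ring

variable {k q : ℕ} {lam : Fin (k + q) → ℝ}

/-- On a ball of noise vectors, the squared error of the proximal point is given exactly by the
block description. -/
lemma sum_sq_error_eq_of_small (hlam : Antitone lam) (hnonneg : ∀ i, 0 ≤ lam i)
    (τ : Equiv.Perm (Fin (k + q))) {x h v : Fin (k + q) → ℝ} {z : Fin q → ℝ}
    {σ χ ρ : ℝ} (hσ : 0 ≤ σ) (hχ : 0 ≤ χ) (hρ : 0 < ρ)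
    (hx : ∀ j : Fin q, x (τ (Fin.natAdd k j)) = 0)
    (hgap : ∀ i : Fin k, 2 * ρ ≤ |x (τ (Fin.castAdd q i))|)
    (hgap' : ∀ (i : Fin k) (j : Fin (k + q)), Fin.castAdd q i < j →
      2 * ρ ≤ |x (τ (Fin.castAdd q i))| - |x (τ j)|)
    (hz : IsSlopeProx (fun j => lam (Fin.natAdd k j)) χ (fun j => h (τ (Fin.natAdd k j))) z)
    (hv : IsSlopeProx lam (σ * χ) (fun i => x i + σ * h i) v)
    (hsmall : ∀ i, σ * (√(∑ j, h j ^ 2) + χ * lam i) ≤ ρ) :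
    ∑ i, (v i - x i) ^ 2 = σ ^ 2 * (∑ i : Fin k, (h (τ (Fin.castAdd q i))
      - χ * lam (Fin.castAdd q i) * Real.sign (x (τ (Fin.castAdd q i)))) ^ 2
      + ∑ j, z j ^ 2) := by
  have hanti : Antitone fun j => lam (Fin.natAdd k j) := fun i j hij =>
    hlam ((Fin.natAdd_le_natAdd_iff k).2 hij)
  set s : Fin k → ℝ := fun i => Real.sign (x (τ (Fin.castAdd q i))) with hs_def
  set w : Fin (k + q) → ℝ := fun i => Fin.addCases (motive := fun _ => ℝ)
    (fun i => x (τ (Fin.castAdd q i)) + σ * (h (τ (Fin.castAdd q i))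
      - χ * lam (Fin.castAdd q i) * s i)) (fun j => σ * z j) (τ.symm i) with hw_def
  have hw₁ : ∀ i : Fin k, w (τ (Fin.castAdd q i)) = x (τ (Fin.castAdd q i))
      + σ * (h (τ (Fin.castAdd q i)) - χ * lam (Fin.castAdd q i) * s i) := fun i => by
    simp [hw_def]
  have hw₂ : ∀ j : Fin q, w (τ (Fin.natAdd k j)) = σ * z j := fun j => by simp [hw_def]
  have hs : ∀ i, |s i| ≤ 1 := fun i => by
    rcases Real.sign_apply_eq (x (τ (Fin.castAdd q i))) with h | h | h <;> simp [hs_def, h]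
  have hh : ∀ i, |h i| ≤ √(∑ j, h j ^ 2) := fun i => by
    refine Real.abs_le_sqrt ?_
    exact Finset.single_le_sum (f := fun j => h j ^ 2) (fun j _ => sq_nonneg _)
      (Finset.mem_univ i)
  have hzle : ∀ j, |z j| ≤ √(∑ j, h j ^ 2) := fun j => by
    refine Real.abs_le_sqrt ?_
    calc z j ^ 2 ≤ ∑ j, z j ^ 2 :=
          Finset.single_le_sum (f := fun j => z j ^ 2) (fun j _ => sq_nonneg _)
            (Finset.mem_univ j)
      _ ≤ ∑ j, h (τ (Fin.natAdd k j)) ^ 2 := hz.sum_sq_le hanti (fun j => hnonneg _) hχ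
      _ ≤ ∑ i, h i ^ 2 := by
          rw [← Equiv.sum_comp τ, Fin.sum_univ_add]
          exact le_add_of_nonneg_left (Finset.sum_nonneg fun _ _ => sq_nonneg _)
  have hclose : ∀ j, |w (τ j) - x (τ j)| ≤ ρ := fun j => by
    refine le_trans ?_ (hsmall j)
    induction j using Fin.addCases with
    | left i =>
      rw [hw₁, add_sub_cancel_left, abs_mul, abs_of_nonneg hσ]
      refine mul_le_mul_of_nonneg_left ((abs_sub _ _).trans (add_le_add (hh _) ?_)) hσ
      have hc : 0 ≤ χ * lam (Fin.castAdd q i) := mul_nonneg hχ (hnonneg _)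
      rw [abs_mul, abs_of_nonneg hc]
      exact mul_le_of_le_one_right hc (hs i)
    | right j =>
      rw [hw₂, hx, sub_zero, abs_mul, abs_of_nonneg hσ]
      exact mul_le_mul_of_nonneg_left
        (le_add_of_le_of_nonneg (hzle j) (mul_nonneg hχ (hnonneg _))) hσ
  have hprox := isSlopeProx_of_split hlam hnonneg τ hσ hχ hz hx hw₁ hw₂ hs
    (fun i => sign_mul_eq_abs_of_abs_sub_le hρ (hgap i) (hclose _))
    fun i j hij => by
      have h1 := hgap' i j hij
      have h2 := (abs_sub_abs_le_abs_sub _ _).trans (hclose j)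
      have h3 := (abs_sub_abs_le_abs_sub _ _).trans
        ((abs_sub_comm _ _).trans_le (hclose (Fin.castAdd q i)))
      linarith
  rw [hv.unique hlam hnonneg (mul_nonneg hσ hχ) hprox, ← Equiv.sum_comp τ, Fin.sum_univ_add,
    mul_add, Finset.mul_sum, Finset.mul_sum]
  congr 1
  · exact Finset.sum_congr rfl fun i _ => by rw [hw₁]; ring
  · exact Finset.sum_congr rfl fun j _ => by rw [hw₂, hx]; ring

/-- Uniformly over bounded regularization, the normalized risk is asymptotically bounded below by
its limiting value. -/
lemma exists_mul_le_integral_sum_sq_error (hlam : Antitone lam) (hnonneg : ∀ i, 0 ≤ lam i)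
    (τ : Equiv.Perm (Fin (k + q))) {x : Fin (k + q) → ℝ} {ρ : ℝ} (hρ : 0 < ρ)
    (hx : ∀ j : Fin q, x (τ (Fin.natAdd k j)) = 0)
    (hgap : ∀ i : Fin k, 2 * ρ ≤ |x (τ (Fin.castAdd q i))|)
    (hgap' : ∀ (i : Fin k) (j : Fin (k + q)), Fin.castAdd q i < j →
      2 * ρ ≤ |x (τ (Fin.castAdd q i))| - |x (τ j)|)
    {η : ℝ → (Fin (k + q) → ℝ) → Fin (k + q) → ℝ}
    (hη : ∀ γ u, 0 ≤ γ → IsSlopeProx lam γ u (η γ u))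
    {ηq : ℝ → (Fin q → ℝ) → Fin q → ℝ}
    (hηq : ∀ γ u, 0 ≤ γ → IsSlopeProx (fun j => lam (Fin.natAdd k j)) γ u (ηq γ u))
    {C : ℝ} (hC : 0 < C) {ε : ℝ} (hε : 0 < ε) :
    ∃ σ₀ : ℝ, 0 < σ₀ ∧ ∀ σ χ : ℝ, 0 < σ → σ < σ₀ → 0 < χ → χ ≤ C →
      σ ^ 2 * (k + χ ^ 2 * ∑ i : Fin k, lam (Fin.castAdd q i) ^ 2
          + ∫ h, ∑ j, ηq χ h j ^ 2 ∂stdGaussian q - ε) ≤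
        ∫ h, ∑ i, (η (σ * χ) (fun j => x j + σ * h j) i - x i) ^ 2 ∂stdGaussian (k + q) := by
  have hanti : Antitone fun j => lam (Fin.natAdd k j) := fun i j hij =>
    hlam ((Fin.natAdd_le_natAdd_iff k).2 hij)
  set L := ∑ i, lam i with hL
  have hlamL : ∀ i, lam i ≤ L := fun i =>
    Finset.single_le_sum (f := lam) (fun i _ => hnonneg i) (Finset.mem_univ i)
  have hL0 : 0 ≤ L := Finset.sum_nonneg fun i _ => hnonneg i
  set B : (Fin (k + q) → ℝ) → ℝ := fun h => 3 * ∑ i, h i ^ 2 + 2 * k * (C * L) ^ 2 with hB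
  have hBint : Integrable B (stdGaussian (k + q)) :=
    (integrable_sum_sq_stdGaussian.const_mul 3).add (integrable_const _)
  obtain ⟨R, hR, hRB⟩ := exists_setIntegral_compl_sum_sq_le hBint hε
  refine ⟨ρ / (R + C * L), by positivity, fun σ χ hσ hσ₀ hχ hχC => ?_⟩
  have hσR : σ * (R + C * L) ≤ ρ := ((lt_div_iff₀ (by positivity)).1 hσ₀).le
  set A := {h : Fin (k + q) → ℝ | R ^ 2 < ∑ i, h i ^ 2} with hA
  have hAmeas : MeasurableSet A := measurableSet_lt measurable_const (by fun_prop)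
  set c : Fin k → ℝ := fun i =>
    χ * lam (Fin.castAdd q i) * Real.sign (x (τ (Fin.castAdd q i))) with hc
  have hsign : ∀ i : Fin k, Real.sign (x (τ (Fin.castAdd q i))) ^ 2 = 1 := fun i => by
    have : x (τ (Fin.castAdd q i)) ≠ 0 := fun h0 => by
      have := hgap i
      rw [h0, abs_zero] at this
      linarith
    rcases Real.sign_apply_eq_of_ne_zero _ this with h | h <;> rw [h] <;> norm_num
  have hc2 : ∀ i, c i ^ 2 = χ ^ 2 * lam (Fin.castAdd q i) ^ 2 := fun i => by
    rw [hc, mul_pow, mul_pow, hsign, mul_one]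
  have hinj : Function.Injective fun j : Fin q => τ (Fin.natAdd k j) :=
    τ.injective.comp (Fin.natAdd_injective q k)
  have hmp := measurePreserving_comp_stdGaussian hinj
  have hqint := integrable_sum_sq_prox hanti (fun j => hnonneg _) hχ.le fun u => hηq χ u hχ.le
  set G₂ : (Fin (k + q) → ℝ) → ℝ := fun h =>
    ∑ j, ηq χ (fun j => h (τ (Fin.natAdd k j))) j ^ 2 with hG₂
  set G₁ : (Fin (k + q) → ℝ) → ℝ := fun h => ∑ i : Fin k, (h (τ (Fin.castAdd q i)) - c i) ^ 2
    with hG₁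
  have hG₂int : Integrable G₂ (stdGaussian (k + q)) := hmp.integrable_comp_of_integrable hqint
  have hG₁int : Integrable G₁ (stdGaussian (k + q)) :=
    integrable_finsetSum _ fun i _ => integrable_sub_sq_stdGaussian _ _
  have hG₂eq : ∫ h, G₂ h ∂stdGaussian (k + q) = ∫ h, ∑ j, ηq χ h j ^ 2 ∂stdGaussian q := by
    have hcont := continuous_slopeProx hanti (fun j => hnonneg _) hχ.le fun u => hηq χ u hχ.le
    have hcont' : Continuous fun h : Fin q → ℝ => ∑ j, ηq χ h j ^ 2 := by fun_prop
    rw [← hmp.map_eq]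
    exact (integral_map hmp.measurable.aemeasurable hcont'.aestronglyMeasurable).symm
  have hG₁eq : ∫ h, G₁ h ∂stdGaussian (k + q)
      = k + χ ^ 2 * ∑ i : Fin k, lam (Fin.castAdd q i) ^ 2 := by
    rw [integral_finsetSum _ fun i _ => integrable_sub_sq_stdGaussian _ _]
    simp only [integral_sub_sq_stdGaussian, hc2, Finset.sum_add_distrib, Finset.mul_sum]
    simp
  have hGB : ∀ h, G₁ h + G₂ h ≤ B h := fun h => by
    have h1 : G₁ h ≤ 2 * ∑ i : Fin k, h (τ (Fin.castAdd q i)) ^ 2 + 2 * k * (C * L) ^ 2 := by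
      have : ∑ i : Fin k, c i ^ 2 ≤ ∑ _i : Fin k, (C * L) ^ 2 :=
        Finset.sum_le_sum fun i _ => by
          rw [hc2, ← mul_pow]
          exact pow_le_pow_left₀ (mul_nonneg hχ.le (hnonneg _))
            (mul_le_mul hχC (hlamL _) (hnonneg _) hC.le) 2
      have h2 : G₁ h ≤ 2 * ∑ i : Fin k, h (τ (Fin.castAdd q i)) ^ 2 + 2 * ∑ i, c i ^ 2 := by
        rw [Finset.mul_sum, Finset.mul_sum, ← Finset.sum_add_distrib]
        exact Finset.sum_le_sum fun i _ => by
          nlinarith [sq_nonneg (h (τ (Fin.castAdd q i)) + c i)]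
      simp only [Finset.sum_const, Finset.card_univ, Fintype.card_fin, nsmul_eq_mul] at this
      linarith
    have h2 : G₂ h ≤ ∑ j : Fin q, h (τ (Fin.natAdd k j)) ^ 2 :=
      (hηq χ _ hχ.le).sum_sq_le hanti (fun j => hnonneg _) hχ.le
    have h3 : ∑ i, h i ^ 2 = ∑ i : Fin k, h (τ (Fin.castAdd q i)) ^ 2
        + ∑ j : Fin q, h (τ (Fin.natAdd k j)) ^ 2 := by
      rw [← Equiv.sum_comp τ, Fin.sum_univ_add]
    have h4 : 0 ≤ ∑ i : Fin k, h (τ (Fin.castAdd q i)) ^ 2 :=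
      Finset.sum_nonneg fun _ _ => sq_nonneg _
    have h5 : 0 ≤ ∑ j : Fin q, h (τ (Fin.natAdd k j)) ^ 2 :=
      Finset.sum_nonneg fun _ _ => sq_nonneg _
    simp only [hB, h3]
    linarith
  have hind : Integrable (A.indicator B) (stdGaussian (k + q)) := hBint.indicator hAmeas
  calc σ ^ 2 * (k + χ ^ 2 * ∑ i : Fin k, lam (Fin.castAdd q i) ^ 2
          + ∫ h, ∑ j, ηq χ h j ^ 2 ∂stdGaussian q - ε)
      ≤ σ ^ 2 * (∫ h, G₁ h ∂stdGaussian (k + q) + ∫ h, G₂ h ∂stdGaussian (k + q)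
          - ∫ h, A.indicator B h ∂stdGaussian (k + q)) := by
        rw [hG₁eq, hG₂eq, integral_indicator hAmeas]
        gcongr
    _ = ∫ h, σ ^ 2 * (G₁ h + G₂ h - A.indicator B h) ∂stdGaussian (k + q) := by
        rw [integral_const_mul, integral_sub (f := fun h => G₁ h + G₂ h) (hG₁int.add hG₂int) hind,
          integral_add hG₁int hG₂int]
    _ ≤ _ := by
        have hγ : 0 ≤ σ * χ := by positivity
        refine integral_mono (((hG₁int.add hG₂int).sub hind).const_mul _)
          (integrable_sum_sq_error hlam hnonneg hγ fun u => hη _ u hγ) fun h => ?_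
        by_cases hh : h ∈ A
        · simp only [Set.indicator_of_mem hh]
          refine le_trans ?_ (Finset.sum_nonneg fun i _ => sq_nonneg _)
          exact mul_nonpos_of_nonneg_of_nonpos (sq_nonneg σ) (sub_nonpos.2 (hGB h))
        · simp only [Set.indicator_of_notMem hh, sub_zero]
          refine (sum_sq_error_eq_of_small hlam hnonneg τ hσ.le hχ.le hρ hx hgap hgap'
            (hηq χ _ hχ.le) (hη _ _ hγ) fun i => ?_).ge
          refine le_trans (mul_le_mul_of_nonneg_left (add_le_add ?_ ?_) hσ.le) hσR
          · exact Real.sqrt_le_iff.2 ⟨hR.le, not_lt.1 hh⟩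
          · exact mul_le_mul hχC (hlamL _) (hnonneg _) hC.le

end SmallNoise

section Gap

variable {n k : ℕ} {x : Fin n → ℝ}

lemma sort_ne_zero_iff (hxk : {i : Fin n | x i ≠ 0}.ncard = k) (j : Fin n) :
    x (Tuple.sort (fun j => -|x j|) j) ≠ 0 ↔ (j : ℕ) < k := by
  set τ := Tuple.sort fun j => -|x j|
  have hcard : (Finset.univ.filter fun i => x (τ i) ≠ 0).card = k := by
    rw [← hxk, Set.ncard_eq_toFinset_card', Set.toFinset_ofPred]
    refine Finset.card_bij (fun i _ => τ i) (by simp) (fun _ _ _ _ h => τ.injective h)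
      fun b hb => ⟨τ.symm b, ?_⟩
    simpa using hb
  have hanti : ∀ i j, i ≤ j → x (τ j) ≠ 0 → x (τ i) ≠ 0 := fun i j hij hj => by
    have : |x (τ j)| ≤ |x (τ i)| := antitone_sortedAbs x hij
    exact abs_pos.1 ((abs_pos.2 hj).trans_le this)
  constructor
  · intro hj
    have : Finset.Iic j ⊆ Finset.univ.filter fun i => x (τ i) ≠ 0 := fun i hi => by
      simpa using hanti i j (Finset.mem_Iic.1 hi) hj
    have := Finset.card_le_card this
    rw [hcard, Fin.card_Iic] at this
    omega
  · intro hj h0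
    have : (Finset.univ.filter fun i => x (τ i) ≠ 0) ⊆ Finset.Iio j := fun i hi => by
      refine Finset.mem_Iio.2 (lt_of_not_ge fun hji => hanti j i hji ?_ h0)
      simpa using hi
    have := Finset.card_le_card this
    rw [hcard, Fin.card_Iio] at this
    omega

/-- The nonzero sorted absolute values are uniformly separated. -/
lemma exists_gap (hxk : {i : Fin n | x i ≠ 0}.ncard = k)
    (hdistinct : ∀ i j : Fin n, i ≠ j → x i ≠ 0 → x j ≠ 0 → |x i| ≠ |x j|) :
    ∃ ρ : ℝ, 0 < ρ ∧ (∀ i : Fin n, (i : ℕ) < k → 2 * ρ ≤ sortedAbs x i) ∧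
      ∀ i j : Fin n, (i : ℕ) < k → i < j → 2 * ρ ≤ sortedAbs x i - sortedAbs x j := by
  set τ := Tuple.sort fun j => -|x j| with hτ
  have small : ∀ a : ℝ, 0 < a → ∀ᶠ ρ in nhdsWithin (0 : ℝ) (Set.Ioi 0), 2 * ρ ≤ a :=
    fun a ha => by
      filter_upwards [Ioc_mem_nhdsGT (half_pos ha)] with ρ hρ
      linarith [hρ.2]
  have hpos : ∀ i : Fin n, (i : ℕ) < k → 0 < sortedAbs x i := fun i hi =>
    abs_pos.2 ((sort_ne_zero_iff hxk i).2 hi)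
  have hsep : ∀ i j : Fin n, (i : ℕ) < k → i < j → 0 < sortedAbs x i - sortedAbs x j := by
    intro i j hi hij
    refine sub_pos.2 (lt_of_le_of_ne (antitone_sortedAbs x hij.le) fun h => ?_)
    have hxi := (sort_ne_zero_iff hxk i).2 hi
    have hxj : x (τ j) ≠ 0 := abs_pos.1 ((hpos i hi).trans_eq h.symm)
    exact hdistinct _ _ (fun h => hij.ne (τ.injective h)) hxi hxj h.symm
  have h1 : ∀ᶠ ρ in nhdsWithin (0 : ℝ) (Set.Ioi 0), ∀ i : Fin n, (i : ℕ) < k →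
      2 * ρ ≤ sortedAbs x i :=
    eventually_all.2 fun i => eventually_imp_distrib_left.2 fun hi => small _ (hpos i hi)
  have h2 : ∀ᶠ ρ in nhdsWithin (0 : ℝ) (Set.Ioi 0), ∀ i j : Fin n, (i : ℕ) < k → i < j →
      2 * ρ ≤ sortedAbs x i - sortedAbs x j :=
    eventually_all.2 fun i => eventually_all.2 fun j => eventually_imp_distrib_left.2 fun hi =>
      eventually_imp_distrib_left.2 fun hij => small _ (hsep i j hi hij)
  obtain ⟨ρ, ⟨h1, h2⟩, h3⟩ := ((h1.and h2).and self_mem_nhdsWithin).exists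
  exact ⟨ρ, h3, h1, h2⟩

end Gap

section PhaseTransition

/-- Below the phase transition the risk exceeds `δ p σ²` for every tuning once `σ` is small. -/
lemma exists_mul_le_integral_sum_sq_error_of_lt {k q : ℕ} (hp : 0 < k + q) (hk : 0 < k)
    {lam : Fin (k + q) → ℝ} (hlam : Antitone lam) (hnonneg : ∀ i, 0 ≤ lam i)
    (hlam₀ : 0 < lam ⟨0, hp⟩) {x : Fin (k + q) → ℝ}
    (hxk : {i : Fin (k + q) | x i ≠ 0}.ncard = k)
    (hdistinct : ∀ i j : Fin (k + q), i ≠ j → x i ≠ 0 → x j ≠ 0 → |x i| ≠ |x j|)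
    {η : ℝ → (Fin (k + q) → ℝ) → Fin (k + q) → ℝ}
    (hη : ∀ γ u, 0 ≤ γ → IsSlopeProx lam γ u (η γ u))
    {ηq : ℝ → (Fin q → ℝ) → Fin q → ℝ}
    (hηq : ∀ γ u, 0 ≤ γ → IsSlopeProx (fun j => lam (Fin.natAdd k j)) γ u (ηq γ u))
    {m m' : ℝ} (hm : 0 < m) (hmm' : m < m')
    (hF : ∀ χ : ℝ, 0 < χ → m' ≤ k + χ ^ 2 * ∑ i : Fin k, lam (Fin.castAdd q i) ^ 2
      + ∫ h, ∑ j, ηq χ h j ^ 2 ∂stdGaussian q) :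
    ∃ σ₀ : ℝ, 0 < σ₀ ∧ ∀ σ χ : ℝ, 0 < σ → σ < σ₀ → 0 < χ →
      σ ^ 2 * m ≤
        ∫ h, ∑ i, (η (σ * χ) (fun j => x j + σ * h j) i - x i) ^ 2 ∂stdGaussian (k + q) := by
  obtain ⟨ρ, hρ, hgap, hgap'⟩ := exists_gap hxk hdistinct
  set τ := Tuple.sort fun j => -|x j| with hτ
  set T : ℝ := m + (k + q : ℕ) with hT
  have hT0 : 0 < T := by positivity
  set l := lam ⟨0, hp⟩
  set C : ℝ := √(2 * (k + q : ℕ) * T) / l + 1 with hC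
  have hC0 : 0 < C := by positivity
  obtain ⟨σ₁, hσ₁, hsmall⟩ := exists_mul_le_integral_sum_sq_error hlam hnonneg τ hρ
    (fun j => by
      by_contra h0
      have := (sort_ne_zero_iff hxk _).1 h0
      simp at this)
    (fun i => hgap _ (by simp)) (fun i j hij => hgap' _ _ (by simp) hij) hη hηq hC0
    (sub_pos.2 hmm')
  set X := ∑ i, x i ^ 2 with hX
  have hX0 : 0 < X := by
    have h0 := (sort_ne_zero_iff hxk ⟨0, hp⟩).2 hk
    exact Finset.sum_pos' (fun i _ => sq_nonneg _) ⟨_, Finset.mem_univ _, sq_pos_of_ne_zero h0⟩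
  refine ⟨min σ₁ (√(X / T)), lt_min hσ₁ (by positivity), fun σ χ hσ hσ₀ hχ => ?_⟩
  rcases le_or_gt χ C with hχC | hχC
  · refine le_trans ?_ (hsmall σ χ hσ (hσ₀.trans_le (min_le_left _ _)) hχ hχC)
    exact mul_le_mul_of_nonneg_left (by linarith [hF χ hχ]) (sq_nonneg σ)
  · have h1 : σ ^ 2 * T ≤ X := by
      have := (Real.lt_sqrt hσ.le).1 (hσ₀.trans_le (min_le_right _ _))
      exact ((lt_div_iff₀ hT0).1 this).le
    have h2 : 2 * ((k + q : ℕ) : ℝ) * T ≤ (χ * l) ^ 2 := by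
      refine (Real.sqrt_le_left (by positivity)).1 ((div_le_iff₀ hlam₀).1 ?_)
      linarith
    have := mul_le_integral_sum_sq_error_of_large hlam hnonneg hp hσ hχ
      (fun u => hη (σ * χ) u (by positivity)) ⟨0, hp⟩ h1 h2
    rwa [hT, add_sub_cancel_right] at this

/-- If `f` is eventually bounded above and bounded below by a positive constant, its liminf at `0⁺`
is positive and it dominates `s ^ 2`. -/
lemma liminf_pos_and_tendsto_div_sq {f : ℝ → ℝ} {c K : ℝ} (hc : 0 < c)
    (hlow : ∀ᶠ s in nhdsWithin (0 : ℝ) (Set.Ioi 0), c ≤ f s)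
    (hup : ∀ᶠ s in nhdsWithin (0 : ℝ) (Set.Ioi 0), f s ≤ K) :
    0 < liminf f (nhdsWithin 0 (Set.Ioi 0)) ∧
      Tendsto (fun s => f s / s ^ 2) (nhdsWithin 0 (Set.Ioi 0)) atTop := by
  refine ⟨hc.trans_le (le_liminf_of_le (isBoundedUnder_of_eventually_le hup).isCoboundedUnder_ge
    hlow), ?_⟩
  have h1 : Tendsto (fun s : ℝ => c * (s⁻¹) ^ 2) (nhdsWithin 0 (Set.Ioi 0)) atTop :=
    ((tendsto_pow_atTop two_ne_zero).comp tendsto_inv_nhdsGT_zero).const_mul_atTop hc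
  refine tendsto_atTop_mono' _ ?_ h1
  filter_upwards [hlow] with s hs
  rw [inv_pow, ← div_eq_mul_inv]
  exact div_le_div_of_nonneg_right hs (sq_nonneg s)

end PhaseTransition

/-- below the phase transition (`δ < M_λ`), the optimally tuned
asymptotic MSE of SLOPE stays bounded away from 0 as `σ_z → 0⁺`, and
`δ(σ*(σ_z)² − σ_z²)/σ_z² → ∞`. -/
theorem slope_low_noise_below_phase_transition
    (p k : ℕ) (hp : 1 ≤ p) (hk1 : 1 ≤ k) (hkp : k ≤ p)
    (lam : Fin p → ℝ)
    (hmono : ∀ i j : Fin p, i ≤ j → lam j ≤ lam i)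
    (hnonneg : ∀ i, 0 ≤ lam i)
    (hlam1 : 0 < lam ⟨0, hp⟩)
    (x : Fin p → ℝ)
    (hxk : {i : Fin p | x i ≠ 0}.ncard = k)
    (hdistinct : ∀ i j : Fin p, i ≠ j → x i ≠ 0 → x j ≠ 0 → |x i| ≠ |x j|)
    (δ : ℝ) (hδ : 0 < δ)
    (ηp : ℝ → (Fin p → ℝ) → (Fin p → ℝ))
    (hηp : ∀ γ u, 0 ≤ γ → IsSlopeProx lam γ u (ηp γ u))
    (lamq : Fin (p - k) → ℝ)
    (hlamq : ∀ i : Fin (p - k), lamq i = lam ⟨k + i.val, by have := i.isLt; omega⟩)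
    (ηq : ℝ → (Fin (p - k) → ℝ) → (Fin (p - k) → ℝ))
    (hηq : ∀ γ u, 0 ≤ γ → IsSlopeProx lamq γ u (ηq γ u))
    (M : ℝ)
    (hM : M = (1 / (p : ℝ)) * sInf {m : ℝ | ∃ α : ℝ, 0 < α ∧
      m = (k : ℝ) + α ^ 2 * (∑ i : Fin p, if (i : ℕ) < k then lam i ^ 2 else 0)
        + ∫ ht, (∑ i, (ηq α ht i) ^ 2) ∂ stdGaussian (p - k)})
    (hPT : δ < M)
    (σs : ℝ → ℝ)
    (hσs : ∀ σz : ℝ, 0 < σz → 0 < σs σz ∧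
      (σs σz) ^ 2 = σz ^ 2 + (1 / (δ * (p : ℝ))) * sInf {m : ℝ | ∃ χ : ℝ, 0 < χ ∧
        m = ∫ h, (∑ i, (ηp (σs σz * χ) (fun j => x j + σs σz * h j) i - x i) ^ 2)
          ∂ stdGaussian p}) :
    0 < Filter.liminf (fun σz => δ * ((σs σz) ^ 2 - σz ^ 2)) (nhdsWithin 0 (Set.Ioi 0)) ∧
    Filter.Tendsto (fun σz => δ * ((σs σz) ^ 2 - σz ^ 2) / σz ^ 2)
      (nhdsWithin 0 (Set.Ioi 0)) Filter.atTop := by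
  obtain ⟨q, rfl⟩ := Nat.exists_eq_add_of_le hkp
  have hlamq' : ∀ (i : Fin (k + q - k)) (h : k + i.val < k + q), lamq i = lam ⟨k + i.val, h⟩ :=
    fun i _ => hlamq i
  clear hlamq
  have hq : k + q - k = q := by omega
  revert lamq ηq
  generalize k + q - k = r at hq
  subst hq
  intro lamq ηq hηq hM hlamq
  have hlam : Antitone lam := fun i j hij => hmono i j hij
  obtain rfl : lamq = fun j => lam (Fin.natAdd k j) := funext fun j =>
    hlamq j (Nat.add_lt_add_left j.isLt k)
  have hp' : (0 : ℝ) < (k + r : ℕ) := by exact_mod_cast hp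
  have hpδ : 0 < δ * ((k + r : ℕ) : ℝ) := mul_pos hδ hp'
  have hMp : δ * ((k + r : ℕ) : ℝ) < M * ((k + r : ℕ) : ℝ) := mul_lt_mul_of_pos_right hPT hp'
  have hF : ∀ χ : ℝ, 0 < χ → M * ((k + r : ℕ) : ℝ)
      ≤ k + χ ^ 2 * ∑ i : Fin k, lam (Fin.castAdd r i) ^ 2
        + ∫ h, ∑ j, ηq χ h j ^ 2 ∂stdGaussian r := by
    intro χ hχ
    rw [hM, one_div, mul_comm, mul_inv_cancel_left₀ hp'.ne']
    refine csInf_le ⟨0, ?_⟩ ⟨χ, hχ, ?_⟩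
    · rintro _ ⟨α, -, rfl⟩
      have h1 : 0 ≤ ∑ i : Fin (k + r), if (i : ℕ) < k then lam i ^ 2 else 0 :=
        Finset.sum_nonneg fun i _ => by split_ifs <;> positivity
      have h2 : 0 ≤ ∫ h, ∑ j, ηq α h j ^ 2 ∂stdGaussian r :=
        integral_nonneg fun h => Finset.sum_nonneg fun j _ => sq_nonneg _
      positivity
    · rw [Fin.sum_univ_add]
      simp
  obtain ⟨σ₀, hσ₀, hrisk⟩ := exists_mul_le_integral_sum_sq_error_of_lt hp hk1 hlam hnonneg hlam1
    hxk hdistinct hηp hηq hpδ hMp hF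
  have hlow : ∀ s : ℝ, 0 < s → σ₀ ≤ σs s := by
    intro s hs
    obtain ⟨h1, h2⟩ := hσs s hs
    by_contra! hlt
    have h3 : σs s ^ 2 * (δ * ((k + r : ℕ) : ℝ)) ≤ sInf {m : ℝ | ∃ χ : ℝ, 0 < χ ∧
        m = ∫ h, (∑ i, (ηp (σs s * χ) (fun j => x j + σs s * h j) i - x i) ^ 2)
          ∂ stdGaussian (k + r)} := by
      refine le_csInf ⟨_, 1, one_pos, rfl⟩ ?_
      rintro _ ⟨χ, hχ, rfl⟩
      exact hrisk (σs s) χ h1 hlt hχ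
    rw [← le_div_iff₀ hpδ, div_eq_mul_one_div, mul_comm] at h3
    nlinarith [pow_pos hs 2]
  have hup : ∀ s : ℝ, 0 < s →
      δ * (σs s ^ 2 - s ^ 2) ≤ (∑ i, x i ^ 2 + 1) / ((k + r : ℕ) : ℝ) := by
    intro s hs
    obtain ⟨h1, h2⟩ := hσs s hs
    obtain ⟨χ, hχ, hχX⟩ := exists_integral_sum_sq_error_lt hlam hnonneg h1 hηp ⟨0, hp⟩ hlam1
      (lt_add_one (∑ i, x i ^ 2))
    rw [h2, add_sub_cancel_left, one_div, mul_inv, ← mul_assoc, mul_inv_cancel_left₀ hδ.ne',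
      mul_comm, ← div_eq_mul_inv]
    refine div_le_div_of_nonneg_right (le_trans (csInf_le ⟨0, ?_⟩ ⟨χ, hχ, rfl⟩) hχX.le) hp'.le
    rintro _ ⟨α, -, rfl⟩
    exact integral_nonneg fun h => Finset.sum_nonneg fun j _ => sq_nonneg _
  refine liminf_pos_and_tendsto_div_sq (c := δ * (σ₀ ^ 2 / 2))
    (K := (∑ i, x i ^ 2 + 1) / ((k + r : ℕ) : ℝ)) (by positivity) ?_ ?_
  · filter_upwards [Ioo_mem_nhdsGT (half_pos hσ₀)] with s hs
    have h1 := hlow s hs.1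
    refine mul_le_mul_of_nonneg_left ?_ hδ.le
    nlinarith [hs.1, hs.2]
  · filter_upwards [self_mem_nhdsWithin] with s hs using hup s hs
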